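/- arXiv:1211.4803 — 3 statements merged into one kernel-verified Lean document; each statement's English description precedes it below -/
import Mathlib

section
/- Let f : [0,1] → ℝ be any function and let G_f = {(x, f(x)) : x ∈ [0,1]} ⊂ ℝ². Then the Fourier dimension of G_f is at most 1. That is, there do not exist τ > 1, a constant C > 0, and a Borel probability measure μ supported on G_f such that |μ̂(ξ)| ≤ C|ξ|^{−τ/2} for all ξ ∈ ℝ², ξ ≠ 0. -/
open MeasureTheory

noncomputable def ft2 (μ : Measure (ℝ × ℝ)) (ξ : ℝ × ℝ) : ℂ :=
  ∫ x, Complex.exp (-2 * Real.pi * Complex.I * ((x.1 * ξ.1 + x.2 * ξ.2 : ℝ) : ℂ)) ∂μ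

noncomputable def enorm2 (ξ : ℝ × ℝ) : ℝ := Real.sqrt (ξ.1 ^ 2 + ξ.2 ^ 2)

open scoped FourierTransform SchwartzMap

/-- A measure concentrated on the graph of an arbitrary function is concentrated on the graph of
a measurable function. -/
lemma exists_measurable_ae_eq_of_graph {f : ℝ → ℝ} {s : Set ℝ} {μ : Measure (ℝ × ℝ)}
    (hμ : μ {p : ℝ × ℝ | p.1 ∈ s ∧ p.2 = f p.1}ᶜ = 0) :
    ∃ g : ℝ → ℝ, Measurable g ∧ ∀ᵐ p ∂μ, p.1 ∈ s ∧ p.2 = g p.1 := by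
  obtain ⟨t, ht, htm, ht0⟩ := exists_measurable_superset_of_null hμ
  have hA : ∀ p ∈ tᶜ, p.1 ∈ s ∧ p.2 = f p.1 := fun p hp ↦ by
    by_contra h
    exact hp (ht h)
  have := htm.compl.standardBorel
  have hemb : MeasurableEmbedding (fun p : (tᶜ : Set (ℝ × ℝ)) ↦ p.1.1) := by
    refine Measurable.measurableEmbedding (by fun_prop) fun p q hpq ↦ ?_
    have h : p.1.1 = q.1.1 := hpq
    refine Subtype.ext (Prod.ext h ?_)
    rw [(hA _ p.2).2, (hA _ q.2).2, h]
  obtain ⟨g, hg, hgf⟩ := hemb.exists_measurable_extend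
    (g := fun p : (tᶜ : Set (ℝ × ℝ)) ↦ p.1.2) (by fun_prop) fun _ ↦ inferInstance
  refine ⟨g, hg, ?_⟩
  have hae : ∀ᵐ p ∂μ, p ∈ tᶜ := by simpa [ae_iff] using ht0
  filter_upwards [hae] with p hp
  exact ⟨(hA p hp).1, (congrFun hgf ⟨p, hp⟩).symm⟩

lemma norm_exp_neg_two_pi_I_mul (x : ℝ) :
    ‖Complex.exp (-2 * Real.pi * Complex.I * (x : ℂ))‖ = 1 := by
  rw [show -2 * Real.pi * Complex.I * (x : ℂ) = ((-2 * Real.pi * x : ℝ) : ℂ) * Complex.I by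
    push_cast; ring]
  exact Complex.norm_exp_ofReal_mul_I _

/-- Integrating a Schwartz function of the first coordinate against a character of the second
coordinate, expressed on the Fourier side. -/
lemma integral_schwartz_mul_exp_eq (μ : Measure (ℝ × ℝ)) [IsFiniteMeasure μ] (ψ : 𝓢(ℝ, ℂ))
    (η : ℝ) :
    ∫ p, ψ p.1 * Complex.exp (-2 * Real.pi * Complex.I * ((p.2 * η : ℝ) : ℂ)) ∂μ =
      ∫ t, 𝓕 ψ t * ft2 μ (-t, η) := by
  have hint : Integrable (Function.uncurry fun (p : ℝ × ℝ) (t : ℝ) ↦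
      𝓕 ψ t * Complex.exp (-2 * Real.pi * Complex.I * ((p.1 * -t + p.2 * η : ℝ) : ℂ)))
      (μ.prod volume) := by
    have h1 : Integrable (fun z : (ℝ × ℝ) × ℝ ↦ 𝓕 ψ z.2) (μ.prod volume) :=
      (𝓕 ψ).integrable.comp_snd μ
    refine h1.mono ?_ (.of_forall fun z ↦ ?_)
    · have := (𝓕 ψ).continuous
      exact Continuous.aestronglyMeasurable (by unfold Function.uncurry; fun_prop)
    · simp only [Function.uncurry, norm_mul, norm_exp_neg_two_pi_I_mul, mul_one, le_refl]
  calc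
    _ = ∫ p, (∫ t, 𝓕 ψ t *
        Complex.exp (-2 * Real.pi * Complex.I * ((p.1 * -t + p.2 * η : ℝ) : ℂ))) ∂μ := by
      refine integral_congr_ae (.of_forall fun p ↦ ?_)
      have hinv : ψ p.1 = 𝓕⁻ ⇑(𝓕 ψ : 𝓢(ℝ, ℂ)) p.1 := by
        rw [← SchwartzMap.fourierInv_coe, FourierTransform.fourierInv_fourier_eq]
      simp only
      rw [hinv, Real.fourierInv_eq', ← integral_mul_const]
      refine integral_congr_ae (.of_forall fun t ↦ ?_)
      simp only [smul_eq_mul]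
      rw [mul_comm (Complex.exp _) (𝓕 ψ t), mul_assoc, ← Complex.exp_add]
      congr 2
      simp
      ring
    _ = _ := by
      rw [integral_integral_swap hint]
      simp only [ft2, integral_const_mul]

lemma enorm_integral_schwartz_mul_exp_le (μ : Measure (ℝ × ℝ)) [IsFiniteMeasure μ]
    (ψ : 𝓢(ℝ, ℂ)) (η : ℝ) {w : ℝ → ℝ} (hwm : AEStronglyMeasurable w)
    (hw : ∀ t, ‖ft2 μ (-t, η)‖ ≤ w t) :
    ‖∫ p, ψ p.1 * Complex.exp (-2 * Real.pi * Complex.I * ((p.2 * η : ℝ) : ℂ)) ∂μ‖ₑ ≤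
      eLpNorm w 2 volume * eLpNorm ψ 2 volume := by
  have hplancherel : eLpNorm (𝓕 ψ : 𝓢(ℝ, ℂ)) 2 volume = eLpNorm ψ 2 volume := by
    have h := SchwartzMap.norm_fourier_toL2_eq ψ
    rw [SchwartzMap.norm_toLp, SchwartzMap.norm_toLp] at h
    exact (ENNReal.toReal_eq_toReal_iff' ((𝓕 ψ).eLpNorm_lt_top 2 volume).ne
      (ψ.eLpNorm_lt_top 2 volume).ne).1 h
  rw [integral_schwartz_mul_exp_eq, ← hplancherel]
  calc
    _ ≤ eLpNorm (fun t ↦ 𝓕 ψ t * ft2 μ (-t, η)) 1 volume := by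
      rw [eLpNorm_one_eq_lintegral_enorm]
      exact enorm_integral_le_lintegral_enorm _
    _ ≤ eLpNorm (w • ⇑(𝓕 ψ : 𝓢(ℝ, ℂ))) 1 volume := by
      refine eLpNorm_mono fun t ↦ ?_
      rw [norm_mul, Pi.smul_apply', norm_smul, mul_comm]
      gcongr
      exact (hw t).trans (le_abs_self _)
    _ ≤ _ := eLpNorm_smul_le_mul_eLpNorm (𝓕 ψ).continuous.aestronglyMeasurable hwm

lemma enorm2_rpow_le {a t η : ℝ} (ha : 0 < a) (hη : 1 ≤ η) :
    enorm2 (t, η) ^ (-(1 + 2 * a) / 2) ≤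
      η ^ (-(a / 2)) * (1 + ‖t‖ ^ 2) ^ (-((1 + a) / 4)) := by
  have hpos : 0 < t ^ 2 + η ^ 2 := by positivity
  have hη0 : 0 < η := by positivity
  have hηa : η ^ (-(a / 2)) = (η ^ 2) ^ (-(a / 4)) := by
    rw [← Real.rpow_natCast, ← Real.rpow_mul hη0.le]
    congr 1
    push_cast
    ring
  rw [enorm2, Real.sqrt_eq_rpow, ← Real.rpow_mul hpos.le, hηa,
    show 1 / 2 * (-(1 + 2 * a) / 2) = -(a / 4) + -((1 + a) / 4) by ring, Real.rpow_add hpos]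
  gcongr ?_ * ?_
  · exact Real.rpow_le_rpow_of_nonpos (by positivity) (by nlinarith [sq_nonneg t]) (by linarith)
  · refine Real.rpow_le_rpow_of_nonpos (by positivity) ?_ (by linarith)
    rw [Real.norm_eq_abs, sq_abs]
    nlinarith

lemma memLp_two_one_add_norm_sq_rpow {a : ℝ} (ha : 0 < a) :
    MemLp (fun t : ℝ ↦ (1 + ‖t‖ ^ 2) ^ (-((1 + a) / 4))) 2 volume := by
  rw [memLp_two_iff_integrable_sq (Measurable.aestronglyMeasurable (by fun_prop))]
  refine (integrable_rpow_neg_one_add_norm_sq (E := ℝ) (r := 1 + a) (by simpa)).congr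
    (.of_forall fun t ↦ ?_)
  simp only
  rw [← Real.rpow_mul_natCast (by positivity)]
  congr 1
  push_cast
  ring

theorem graph_fourier_dim_le_one (f : ℝ → ℝ) :
    ¬ ∃ (τ C : ℝ) (μ : Measure (ℝ × ℝ)), 1 < τ ∧ 0 < C ∧ IsProbabilityMeasure μ ∧
      μ {p : ℝ × ℝ | p.1 ∈ Set.Icc (0:ℝ) 1 ∧ p.2 = f p.1}ᶜ = 0 ∧
      ∀ ξ : ℝ × ℝ, ξ ≠ 0 → ‖ft2 μ ξ‖ ≤ C * enorm2 ξ ^ (-τ / 2) := by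
  rintro ⟨τ, C, μ, hτ, hC, hprob, hsupp, hdecay⟩
  obtain ⟨g, hg, hgμ⟩ := exists_measurable_ae_eq_of_graph hsupp
  obtain ⟨a, ha, rfl⟩ : ∃ a : ℝ, 0 < a ∧ τ = 1 + 2 * a := ⟨(τ - 1) / 2, by linarith, by ring⟩
  set w : ℝ → ℝ := fun t ↦ (1 + ‖t‖ ^ 2) ^ (-((1 + a) / 4)) with hw
  have hwL : MemLp w 2 volume := memLp_two_one_add_norm_sq_rpow ha
  -- A frequency `η` at which the decay hypothesis gives a small `L²` norm.
  obtain ⟨η, hη, hsmall⟩ : ∃ η : ℝ, 1 ≤ η ∧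
      ‖C * η ^ (-(a / 2))‖ₑ * eLpNorm w 2 volume * 2 < 1 / 2 := by
    have h1 : Filter.Tendsto (fun η : ℝ ↦ C * η ^ (-(a / 2))) Filter.atTop (nhds 0) := by
      simpa using (tendsto_rpow_neg_atTop (half_pos ha)).const_mul C
    have h2 := ENNReal.Tendsto.mul_const (b := 2) (ENNReal.Tendsto.mul_const h1.enorm
      (Or.inr hwL.eLpNorm_ne_top)) (Or.inr ENNReal.ofNat_ne_top)
    simp only [enorm_zero, zero_mul] at h2
    exact ((Filter.eventually_ge_atTop 1).and
      (h2.eventually_lt_const (by norm_num))).exists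
  set ν : Measure ℝ := μ.map Prod.fst with hν
  have : IsProbabilityMeasure ν := Measure.isProbabilityMeasure_map (by fun_prop)
  set h : ℝ → ℂ := (Set.Icc (0 : ℝ) 1).indicator
    fun x ↦ Complex.exp (2 * Real.pi * Complex.I * ((g x * η : ℝ) : ℂ)) with hh
  have hhm : Measurable h := Measurable.indicator (by fun_prop) measurableSet_Icc
  have hhn : ∀ x, ‖h x‖ ≤ ‖(Set.Icc (0 : ℝ) 1).indicator (fun _ ↦ (1 : ℝ)) x‖ := fun x ↦ by
    by_cases hx : x ∈ Set.Icc (0 : ℝ) 1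
    · simp only [hh, Set.indicator_of_mem hx]
      rw [show 2 * Real.pi * Complex.I * ((g x * η : ℝ) : ℂ) =
        -2 * Real.pi * Complex.I * ((-(g x * η) : ℝ) : ℂ) by push_cast; ring,
        norm_exp_neg_two_pi_I_mul, norm_one]
    · simp [hh, Set.indicator_of_notMem hx]
  have : IsFiniteMeasureOnCompacts (volume + ν) :=
    ⟨fun K hK ↦ by simp [hK.measure_lt_top]⟩
  have hhL : MemLp h 2 (volume + ν) :=
    (memLp_indicator_const 2 measurableSet_Icc 1 (Or.inr
      (isCompact_Icc.measure_lt_top.ne))).mono hhm.aestronglyMeasurable (.of_forall hhn)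
  obtain ⟨φ, hφc, hφs, hφ⟩ := hhL.exist_eLpNorm_sub_le (by simp) (by simp)
    (ε := 1 / 2) (by norm_num)
  set ψ : 𝓢(ℝ, ℂ) := hφc.toSchwartzMap hφs
  have hψφ : (ψ : ℝ → ℂ) = φ := rfl
  rw [← hψφ] at hφ
  have hhalf : ENNReal.ofReal (1 / 2) = 1 / 2 := by
    rw [ENNReal.ofReal_div_of_pos (by norm_num)]; simp
  rw [hhalf] at hφ
  have hψ2 : eLpNorm ψ 2 volume ≤ 2 := by
    have e1 : (ψ : ℝ → ℂ) = h - (h - ⇑ψ) := by simp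
    have e2 : eLpNorm h 2 volume ≤ 1 := by
      refine (eLpNorm_mono hhn).trans ?_
      rw [eLpNorm_indicator_const measurableSet_Icc (by simp) (by simp)]
      simp
    have e3 : eLpNorm (h - ⇑ψ) 2 volume ≤ 1 / 2 :=
      (eLpNorm_mono_measure _ (Measure.le_add_right le_rfl)).trans hφ
    rw [e1]
    calc
      _ ≤ eLpNorm h 2 volume + eLpNorm (h - ⇑ψ) 2 volume :=
        eLpNorm_sub_le hhm.aestronglyMeasurable
          (hhm.aestronglyMeasurable.sub ψ.continuous.aestronglyMeasurable) (by simp)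
      _ ≤ 1 + 1 := add_le_add e2 (e3.trans (by simp))
      _ = 2 := one_add_one_eq_two
  set E : ℝ × ℝ → ℂ := fun p ↦
    Complex.exp (-2 * Real.pi * Complex.I * ((p.2 * η : ℝ) : ℂ)) with hE
  have hEn : ∀ p, ‖E p‖ = 1 := fun p ↦ norm_exp_neg_two_pi_I_mul _
  have hEm : Continuous E := by fun_prop
  have hmain : ‖∫ p, ψ p.1 * E p ∂μ‖ₑ < 1 / 2 := by
    refine lt_of_le_of_lt (enorm_integral_schwartz_mul_exp_le μ ψ η
      (w := (C * η ^ (-(a / 2))) • w) (hwL.1.const_smul _) fun t ↦ ?_) ?_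
    · refine (hdecay (-t, η) fun h0 ↦ ?_).trans ?_
      · have := congrArg Prod.snd h0
        simp only [Prod.snd_zero] at this
        linarith
      · rw [Pi.smul_apply, smul_eq_mul, mul_assoc]
        gcongr
        simpa [hw] using enorm2_rpow_le (t := -t) ha hη
    · rw [eLpNorm_const_smul]
      exact lt_of_le_of_lt (by gcongr) hsmall
  have herr : ‖∫ p, (h p.1 - ψ p.1) * E p ∂μ‖ₑ ≤ 1 / 2 := by
    calc
      _ ≤ ∫⁻ p, ‖(h p.1 - ψ p.1) * E p‖ₑ ∂μ := enorm_integral_le_lintegral_enorm _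
      _ = ∫⁻ p, ‖(h - ⇑ψ) p.1‖ₑ ∂μ := by
        refine lintegral_congr fun p ↦ ?_
        rw [enorm_mul, ← ofReal_norm (E p), hEn]
        simp
      _ = eLpNorm (h - ⇑ψ) 1 ν := by
        rw [eLpNorm_one_eq_lintegral_enorm, hν, lintegral_map _ measurable_fst]
        exact (hhm.sub ψ.continuous.measurable).enorm
      _ ≤ eLpNorm (h - ⇑ψ) 2 ν := eLpNorm_le_eLpNorm_of_exponent_le (by simp)
        (hhm.sub ψ.continuous.measurable).aestronglyMeasurable
      _ ≤ _ := (eLpNorm_mono_measure _ (Measure.le_add_left le_rfl)).trans hφ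
  have hone : ∫ p, h p.1 * E p ∂μ = 1 := by
    have : ∀ᵐ p ∂μ, h p.1 * E p = 1 := by
      filter_upwards [hgμ] with p hp
      simp only [hh, hE, Set.indicator_of_mem hp.1]
      rw [← Complex.exp_add, hp.2]
      ring_nf
      exact Complex.exp_zero
    rw [integral_congr_ae this]
    simp
  have hψi : Integrable (fun p ↦ ψ p.1 * E p) μ := by
    have hb : Integrable (fun p : ℝ × ℝ ↦ ψ p.1) μ :=
      (ψ.integrable (μ := ν)).comp_measurable measurable_fst
    refine hb.mono (hb.1.mul hEm.aestronglyMeasurable) (.of_forall fun p ↦ ?_)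
    rw [norm_mul, hEn, mul_one]
  have hhi : Integrable (fun p ↦ h p.1 * E p) μ := by
    by_contra hn
    rw [integral_undef hn] at hone
    exact zero_ne_one hone
  have hsum : (1 : ℂ) = ∫ p, (h p.1 - ψ p.1) * E p ∂μ + ∫ p, ψ p.1 * E p ∂μ := by
    simp_rw [sub_mul]
    rw [integral_sub hhi hψi, sub_add_cancel, hone]
  have hlt : ‖(1 : ℂ)‖ₑ < 1 := by
    rw [hsum]
    calc
      _ ≤ _ := enorm_add_le _ _
      _ < 1 / 2 + 1 / 2 := ENNReal.add_lt_add_of_le_of_lt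
        (ne_top_of_le_ne_top (by simp) herr) herr hmain
      _ = 1 := by rw [one_div]; exact ENNReal.inv_two_add_inv_two
  simp at hlt
end

section
/- Let μ be a Borel probability measure on ℝ² with |μ̂(ξ)| ≤ C|ξ|^{−τ/2} for some τ > 1 and all ξ ≠ 0. Then there is a set of t ∈ ℝ of positive Lebesgue measure such that the vertical line L_t = {(t, y) : y ∈ ℝ} intersects the support of μ in a set of positive Hausdorff dimension. -/
open MeasureTheory

/-- The (topological) support of a measure: points all of whose neighbourhoods
have positive measure. -/
def msupport (μ : Measure (ℝ × ℝ)) : Set (ℝ × ℝ) :=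
  {x | ∀ U ∈ nhds x, 0 < μ U}

lemma integral_gaussian_mul_cexp {ε : ℝ} (hε : 0 < ε) (x : ℝ) :
    ∫ ξ : ℝ, (Real.exp (-Real.pi * (ε * ξ) ^ 2) : ℂ) *
        Complex.exp (-2 * Real.pi * Complex.I * ((x * ξ : ℝ) : ℂ)) =
      ((ε⁻¹ * Real.exp (-Real.pi * (x / ε) ^ 2) : ℝ) : ℂ) := by
  have hb : 0 < (((Real.pi * ε ^ 2 : ℝ)) : ℂ).re := by
    rw [Complex.ofReal_re]; positivity
  have hε' : (ε : ℂ) ≠ 0 := by exact_mod_cast hε.ne'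
  have hpi : (Real.pi : ℂ) ≠ 0 := by exact_mod_cast Real.pi_ne_zero
  have h := fourierIntegral_gaussian hb ((-2 * Real.pi * x : ℝ) : ℂ)
  have hsq : ((Real.pi : ℂ) / ((Real.pi * ε ^ 2 : ℝ) : ℂ)) ^ (1 / 2 : ℂ) = ((ε⁻¹ : ℝ) : ℂ) := by
    have h1 : ((Real.pi : ℂ) / ((Real.pi * ε ^ 2 : ℝ) : ℂ)) = (((ε⁻¹) ^ 2 : ℝ) : ℂ) := by
      push_cast; field_simp
    rw [h1, show (1 / 2 : ℂ) = ((1 / 2 : ℝ) : ℂ) by push_cast; rfl,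
      ← Complex.ofReal_cpow (by positivity), ← Real.sqrt_eq_rpow, Real.sqrt_sq (by positivity)]
  rw [hsq] at h
  convert h using 1
  · congr 1; ext ξ
    rw [mul_comm]
    push_cast
    congr 2 <;> ring
  · push_cast
    congr 2
    field_simp
    ring

lemma norm_ft2_kernel (p ξ : ℝ × ℝ) :
    ‖Complex.exp (-2 * Real.pi * Complex.I * ((p.1 * ξ.1 + p.2 * ξ.2 : ℝ) : ℂ))‖ = 1 := by
  rw [show -2 * Real.pi * Complex.I * ((p.1 * ξ.1 + p.2 * ξ.2 : ℝ) : ℂ) =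
    ((-2 * Real.pi * (p.1 * ξ.1 + p.2 * ξ.2) : ℝ) : ℂ) * Complex.I by push_cast; ring]
  exact Complex.norm_exp_ofReal_mul_I _

lemma norm_ft2_le_one (μ : Measure (ℝ × ℝ)) [IsProbabilityMeasure μ] (ξ : ℝ × ℝ) :
    ‖ft2 μ ξ‖ ≤ 1 := by
  have := norm_integral_le_of_norm_le_const (μ := μ) (C := 1)
    (ae_of_all _ fun p => (norm_ft2_kernel p ξ).le)
  simpa [ft2] using this

lemma norm_ft2_sq (μ : Measure (ℝ × ℝ)) [IsFiniteMeasure μ] (ξ : ℝ × ℝ) :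
    ((‖ft2 μ ξ‖ ^ 2 : ℝ) : ℂ) = ∫ z, Complex.exp (-2 * Real.pi * Complex.I *
      (((z.1.1 - z.2.1) * ξ.1 + (z.1.2 - z.2.2) * ξ.2 : ℝ) : ℂ)) ∂(μ.prod μ) := by
  rw [← Complex.normSq_eq_norm_sq, Complex.normSq_eq_conj_mul_self, mul_comm, ft2,
    ← integral_conj, ← integral_prod_mul]
  congr 1; ext z
  rw [← Complex.exp_conj, ← Complex.exp_add]
  congr 1
  simp only [map_mul, map_neg, Complex.conj_I, Complex.conj_ofReal, map_ofNat]
  push_cast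
  ring

lemma integrable_gaussian_prod {ε δ : ℝ} (hε : 0 < ε) (hδ : 0 < δ) :
    Integrable fun ξ : ℝ × ℝ =>
      Real.exp (-Real.pi * (ε * ξ.1) ^ 2) * Real.exp (-Real.pi * (δ * ξ.2) ^ 2) := by
  have key : ∀ {c : ℝ}, 0 < c → Integrable fun x : ℝ => Real.exp (-Real.pi * (c * x) ^ 2) := by
    intro c hc
    have := integrable_exp_neg_mul_sq (b := Real.pi * c ^ 2) (by positivity)
    refine this.congr (ae_of_all _ fun x => ?_)
    dsimp only
    congr 1
    ring
  exact (key hε).mul_prod (key hδ)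

lemma integral_gaussian_mul_norm_ft2_sq (μ : Measure (ℝ × ℝ)) [IsFiniteMeasure μ]
    {ε δ : ℝ} (hε : 0 < ε) (hδ : 0 < δ) :
    ∫ ξ : ℝ × ℝ, Real.exp (-Real.pi * (ε * ξ.1) ^ 2) * Real.exp (-Real.pi * (δ * ξ.2) ^ 2) *
        ‖ft2 μ ξ‖ ^ 2 =
      ∫ z, (ε⁻¹ * Real.exp (-Real.pi * ((z.1.1 - z.2.1) / ε) ^ 2)) *
        (δ⁻¹ * Real.exp (-Real.pi * ((z.1.2 - z.2.2) / δ) ^ 2)) ∂(μ.prod μ) := by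
  apply Complex.ofReal_injective
  rw [← integral_complex_ofReal, ← integral_complex_ofReal]
  have h1 : ∀ ξ : ℝ × ℝ, ((Real.exp (-Real.pi * (ε * ξ.1) ^ 2) *
      Real.exp (-Real.pi * (δ * ξ.2) ^ 2) * ‖ft2 μ ξ‖ ^ 2 : ℝ) : ℂ) =
      ∫ z, ((Real.exp (-Real.pi * (ε * ξ.1) ^ 2) *
      Real.exp (-Real.pi * (δ * ξ.2) ^ 2) : ℝ) : ℂ) * Complex.exp (-2 * Real.pi * Complex.I *
      (((z.1.1 - z.2.1) * ξ.1 + (z.1.2 - z.2.2) * ξ.2 : ℝ) : ℂ)) ∂(μ.prod μ) := by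
    intro ξ
    rw [Complex.ofReal_mul, norm_ft2_sq, integral_const_mul]
  simp_rw [h1]
  rw [integral_integral_swap]
  · congr 1; ext z
    rw [Complex.ofReal_mul, ← integral_gaussian_mul_cexp hε, ← integral_gaussian_mul_cexp hδ,
      ← integral_prod_mul]
    congr 1; ext ξ
    have : ∀ a b c d : ℂ, a * b * (c * d) = (a * c) * (b * d) := fun _ _ _ _ => by ring
    rw [this, ← Complex.exp_add]
    push_cast
    congr 2
    ring
  · refine Integrable.mono' (g := fun w : (ℝ × ℝ) × ((ℝ × ℝ) × (ℝ × ℝ)) =>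
      Real.exp (-Real.pi * (ε * w.1.1) ^ 2) * Real.exp (-Real.pi * (δ * w.1.2) ^ 2))
      ((integrable_gaussian_prod hε hδ).comp_fst _) ?_ (ae_of_all _ fun w => ?_)
    · apply Continuous.aestronglyMeasurable
      simp only [Function.uncurry_def]
      fun_prop
    · have := norm_ft2_kernel (w.2.1 - w.2.2) w.1
      simp only [Prod.fst_sub, Prod.snd_sub] at this
      simp only [Function.uncurry_def, norm_mul, this, mul_one]
      rw [Complex.norm_real, Real.norm_of_nonneg (by positivity)]

lemma integrable_abs_rpow_mul_gaussian {b : ℝ} (hb : b < 1) :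
    Integrable fun u : ℝ => |u| ^ (-b) * Real.exp (-Real.pi * u ^ 2) := by
  have h := integrableOn_rpow_mul_exp_neg_mul_sq Real.pi_pos (s := -b) (by linarith)
  have h' := h.integrable_indicator measurableSet_Ioi
  refine (h'.add h'.comp_neg).congr ?_
  filter_upwards [compl_mem_ae_iff.2 (measure_singleton (0 : ℝ))] with u hu
  rcases lt_or_gt_of_ne (show u ≠ 0 from hu) with hu | hu
  · simp [Set.indicator, hu, hu.le, abs_of_neg hu, not_lt_of_ge]
  · simp [Set.indicator, hu, hu.le, abs_of_pos hu, not_lt_of_ge]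

lemma abs_rpow_mul_gaussian_scale {b δ : ℝ} (hδ : 0 < δ) (η : ℝ) :
    |η| ^ (-b) * Real.exp (-Real.pi * (δ * η) ^ 2) =
      δ ^ b * (|δ * η| ^ (-b) * Real.exp (-Real.pi * (δ * η) ^ 2)) := by
  rw [abs_mul, abs_of_pos hδ, Real.mul_rpow hδ.le (abs_nonneg _), ← mul_assoc, ← mul_assoc,
    ← Real.rpow_add hδ]
  simp

lemma norm_ft2_sq_le (μ : Measure (ℝ × ℝ)) [IsProbabilityMeasure μ]
    {C τ b : ℝ} (hb : 0 < b) (hbτ : 1 + 2 * b ≤ τ)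
    (hdecay : ∀ ξ : ℝ × ℝ, ξ ≠ 0 → ‖ft2 μ ξ‖ ≤ C * enorm2 ξ ^ (-τ / 2))
    (ξ : ℝ × ℝ) (hξ : ξ.2 ≠ 0) :
    ‖ft2 μ ξ‖ ^ 2 ≤ 2 ^ (1 + b) * (1 + C ^ 2) * ((1 + |ξ.1|) ^ (-(1 + b)) * |ξ.2| ^ (-b)) := by
  have hη : 0 < |ξ.2| := abs_pos.2 hξ
  have h1 : |ξ.1| ≤ enorm2 ξ := Real.abs_le_sqrt (by nlinarith [sq_nonneg ξ.2])
  have h2 : |ξ.2| ≤ enorm2 ξ := Real.abs_le_sqrt (by nlinarith [sq_nonneg ξ.1])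
  have hr : 0 < enorm2 ξ := hη.trans_le h2
  have hone : 0 < 1 + |ξ.1| := by positivity
  have key : ∀ R : ℝ, 1 ≤ R → enorm2 ξ ≤ R →
      R ^ (-(1 + 2 * b)) ≤ 2 ^ (1 + b) * ((1 + |ξ.1|) ^ (-(1 + b)) * |ξ.2| ^ (-b)) := by
    intro R hR hrR
    have hR0 : 0 < R := by linarith
    have e1 : (2 * R) ^ (-(1 + b)) ≤ (1 + |ξ.1|) ^ (-(1 + b)) :=
      Real.rpow_le_rpow_of_nonpos hone (by linarith) (by linarith)
    have e2 : R ^ (-b) ≤ |ξ.2| ^ (-b) :=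
      Real.rpow_le_rpow_of_nonpos hη (by linarith) (by linarith)
    calc R ^ (-(1 + 2 * b)) = 2 ^ (1 + b) * ((2 * R) ^ (-(1 + b)) * R ^ (-b)) := by
          rw [Real.mul_rpow two_pos.le hR0.le, Real.rpow_neg two_pos.le,
            show -(1 + 2 * b) = -(1 + b) + -b by ring, Real.rpow_add hR0]
          field_simp
      _ ≤ _ := by gcongr
  set W := 2 ^ (1 + b) * ((1 + |ξ.1|) ^ (-(1 + b)) * |ξ.2| ^ (-b)) with hW
  suffices ‖ft2 μ ξ‖ ^ 2 ≤ (1 + C ^ 2) * W by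
    rw [hW] at this; linarith
  have hW0 : 0 ≤ W := by positivity
  rcases le_total (enorm2 ξ) 1 with hle | hge
  · have hk := key 1 le_rfl hle
    rw [Real.one_rpow] at hk
    have := norm_ft2_le_one μ ξ
    have := norm_nonneg (ft2 μ ξ)
    nlinarith [sq_nonneg C, mul_nonneg (sq_nonneg C) hW0]
  · have hk := key _ hge le_rfl
    have hd := hdecay ξ (fun h => hξ (by simp [h]))
    calc ‖ft2 μ ξ‖ ^ 2 ≤ (C * enorm2 ξ ^ (-τ / 2)) ^ 2 := by gcongr
      _ = C ^ 2 * enorm2 ξ ^ (-τ) := by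
          rw [mul_pow, ← Real.rpow_natCast (enorm2 ξ ^ (-τ / 2)), ← Real.rpow_mul hr.le]
          congr 2; push_cast; ring
      _ ≤ C ^ 2 * enorm2 ξ ^ (-(1 + 2 * b)) := by gcongr
      _ ≤ C ^ 2 * W := by gcongr
      _ ≤ (1 + C ^ 2) * W := by nlinarith

lemma exists_measure_rectangle_le (μ : Measure (ℝ × ℝ)) [IsProbabilityMeasure μ]
    {C τ b : ℝ} (hb : 0 < b) (hb1 : b < 1) (hbτ : 1 + 2 * b ≤ τ)
    (hdecay : ∀ ξ : ℝ × ℝ, ξ ≠ 0 → ‖ft2 μ ξ‖ ≤ C * enorm2 ξ ^ (-τ / 2)) :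
    ∃ K : ℝ, 0 ≤ K ∧ ∀ ε δ : ℝ, 0 < ε → 0 < δ →
      (μ.prod μ) {z | |z.1.1 - z.2.1| ≤ ε ∧ |z.1.2 - z.2.2| ≤ δ} ≤
        ENNReal.ofReal (K * ε * δ ^ b) := by
  set M : ℝ := 2 ^ (1 + b) * (1 + C ^ 2) with hM
  set A : ℝ := ∫ x : ℝ, (1 + |x|) ^ (-(1 + b)) with hA
  set B : ℝ := ∫ u : ℝ, |u| ^ (-b) * Real.exp (-Real.pi * u ^ 2) with hB
  have hA0 : 0 ≤ A := integral_nonneg fun x => by positivity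
  have hB0 : 0 ≤ B := integral_nonneg fun x => by positivity
  have hM0 : 0 ≤ M := by positivity
  refine ⟨Real.exp (2 * Real.pi) * (M * (A * B)), by positivity, fun ε δ hε hδ => ?_⟩
  have hAi : Integrable fun x : ℝ => (1 + |x|) ^ (-(1 + b)) := by
    have := integrable_one_add_norm (E := ℝ) (μ := volume) (r := 1 + b) (by simp [hb])
    simpa using this
  have hBi : Integrable fun η : ℝ => |η| ^ (-b) * Real.exp (-Real.pi * (δ * η) ^ 2) := by
    simp_rw [abs_rpow_mul_gaussian_scale hδ]
    exact ((integrable_abs_rpow_mul_gaussian hb1).comp_mul_left' hδ.ne').const_mul _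
  have hBe : ∫ η : ℝ, |η| ^ (-b) * Real.exp (-Real.pi * (δ * η) ^ 2) = δ ^ b * (δ⁻¹ * B) := by
    simp_rw [abs_rpow_mul_gaussian_scale hδ]
    rw [integral_const_mul,
      Measure.integral_comp_mul_left (fun u : ℝ => |u| ^ (-b) * Real.exp (-Real.pi * u ^ 2)) δ,
      abs_of_pos (inv_pos.2 hδ), smul_eq_mul]
  have hup : ∫ ξ : ℝ × ℝ, Real.exp (-Real.pi * (ε * ξ.1) ^ 2) *
      Real.exp (-Real.pi * (δ * ξ.2) ^ 2) * ‖ft2 μ ξ‖ ^ 2 ≤ M * (A * (δ ^ b * (δ⁻¹ * B))) := by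
    rw [← hBe, hA, ← integral_prod_mul, ← integral_const_mul]
    refine integral_mono_of_nonneg (ae_of_all _ fun ξ => by positivity)
      ((hAi.mul_prod hBi).const_mul M) ?_
    have hne : ∀ᵐ ξ : ℝ × ℝ, ξ.2 ≠ 0 :=
      Measure.quasiMeasurePreserving_snd.ae (compl_mem_ae_iff.2 (measure_singleton (0 : ℝ)))
    filter_upwards [hne] with ξ hξ
    have h1 : Real.exp (-Real.pi * (ε * ξ.1) ^ 2) ≤ 1 := by
      rw [Real.exp_le_one_iff]
      nlinarith [mul_nonneg Real.pi_pos.le (sq_nonneg (ε * ξ.1))]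
    have h2 := norm_ft2_sq_le μ hb hbτ hdecay ξ hξ
    calc Real.exp (-Real.pi * (ε * ξ.1) ^ 2) * Real.exp (-Real.pi * (δ * ξ.2) ^ 2) *
          ‖ft2 μ ξ‖ ^ 2
        ≤ 1 * Real.exp (-Real.pi * (δ * ξ.2) ^ 2) *
          (M * ((1 + |ξ.1|) ^ (-(1 + b)) * |ξ.2| ^ (-b))) := by gcongr
      _ = _ := by ring
  rw [integral_gaussian_mul_norm_ft2_sq μ hε hδ] at hup
  set F : (ℝ × ℝ) × (ℝ × ℝ) → ℝ := fun z =>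
    (ε⁻¹ * Real.exp (-Real.pi * ((z.1.1 - z.2.1) / ε) ^ 2)) *
        (δ⁻¹ * Real.exp (-Real.pi * ((z.1.2 - z.2.2) / δ) ^ 2)) with hF
  have hFi : Integrable F (μ.prod μ) := by
    refine Integrable.of_bound (C := ε⁻¹ * δ⁻¹)
      (Continuous.aestronglyMeasurable (by fun_prop)) (ae_of_all _ fun z => ?_)
    rw [Real.norm_of_nonneg (by positivity)]
    have hg : ∀ t : ℝ, Real.exp (-Real.pi * t ^ 2) ≤ 1 := fun t => by
      rw [Real.exp_le_one_iff]
      nlinarith [mul_nonneg Real.pi_pos.le (sq_nonneg t)]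
    calc F z ≤ (ε⁻¹ * 1) * (δ⁻¹ * 1) := by
          simp only [hF]; gcongr <;> apply hg
      _ = _ := by ring
  have hmarkov := mul_meas_ge_le_integral_of_nonneg (ae_of_all _ fun z => by positivity) hFi
    (ε⁻¹ * δ⁻¹ * Real.exp (-(2 * Real.pi)))
  have hsub : {z : (ℝ × ℝ) × (ℝ × ℝ) | |z.1.1 - z.2.1| ≤ ε ∧ |z.1.2 - z.2.2| ≤ δ} ⊆
      {z | ε⁻¹ * δ⁻¹ * Real.exp (-(2 * Real.pi)) ≤ F z} := by
    rintro z ⟨h1, h2⟩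
    have hg : ∀ {t s : ℝ}, 0 < s → |t| ≤ s →
        Real.exp (-Real.pi) ≤ Real.exp (-Real.pi * (t / s) ^ 2) := fun {t s} hs hts => by
      rw [Real.exp_le_exp]
      have : (t / s) ^ 2 ≤ 1 := by
        rw [sq_le_one_iff_abs_le_one, abs_div, abs_of_pos hs]
        exact (div_le_one hs).2 hts
      nlinarith [Real.pi_pos]
    calc ε⁻¹ * δ⁻¹ * Real.exp (-(2 * Real.pi))
        = (ε⁻¹ * Real.exp (-Real.pi)) * (δ⁻¹ * Real.exp (-Real.pi)) := by
          rw [show -(2 * Real.pi) = -Real.pi + -Real.pi by ring, Real.exp_add]; ring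
      _ ≤ F z := by
          have e1 := hg hε h1
          have e2 := hg hδ h2
          simp only [hF]
          exact mul_le_mul (mul_le_mul_of_nonneg_left e1 (by positivity))
            (mul_le_mul_of_nonneg_left e2 (by positivity)) (by positivity) (by positivity)
  refine (measure_mono hsub).trans ?_
  rw [ENNReal.le_ofReal_iff_toReal_le (measure_ne_top _ _) (by positivity)]
  have h := hmarkov.trans hup
  have hc : 0 < ε⁻¹ * δ⁻¹ * Real.exp (-(2 * Real.pi)) := by positivity
  rw [← le_div_iff₀' hc] at h
  refine h.trans (le_of_eq ?_)
  rw [Real.exp_neg]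
  field_simp

open Filter Topology in
lemma measure_sq_le_of_isOpen {X : Type*} [PseudoMetricSpace X] [SecondCountableTopology X]
    [MeasurableSpace X] [BorelSpace X] (m ν : Measure X) [SFinite m] [IsFiniteMeasure ν]
    {M : ENNReal} {ε : ℕ → ℝ} {V : ℕ → ENNReal} (hε : Tendsto ε atTop (𝓝[>] 0))
    (hV : ∀ k x, m (Metric.ball x (ε k)) = V k) (hV0 : ∀ k, V k ≠ 0) (hVt : ∀ k, V k ≠ ⊤)
    (hM : ∀ k, (ν.prod ν) {z | dist z.1 z.2 < 2 * ε k} ≤ M * V k) {U : Set X} (hU : IsOpen U) :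
    ν U ^ 2 ≤ M * m U := by
  set φ : ℕ → X → ENNReal := fun k x => (V k)⁻¹ * m (Metric.ball x (ε k) ∩ U) with hφ
  have hS : ∀ k, MeasurableSet {w : X × X | dist w.2 w.1 < ε k ∧ w.2 ∈ U} := fun k =>
    ((isOpen_lt (continuous_snd.dist continuous_fst) continuous_const).and
      (hU.preimage continuous_snd)).measurableSet
  have hφm : ∀ k, Measurable (φ k) := fun k =>
    (measurable_measure_prodMk_left (ν := m) (hS k)).const_mul _
  have hbound : ∀ k, (∫⁻ x, φ k x ∂ν) ^ 2 ≤ M * m U := by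
    intro k
    set N : X → ENNReal := fun z => ν (Metric.ball z (ε k)) with hN
    have hNm : Measurable N :=
      measurable_measure_prodMk_left (ν := ν) (s := {w : X × X | dist w.2 w.1 < ε k})
        (isOpen_lt (by fun_prop) continuous_const).measurableSet
    have hswap : ∫⁻ x, m (Metric.ball x (ε k) ∩ U) ∂ν = ∫⁻ z, U.indicator 1 z * N z ∂m := by
      have h1 := Measure.prod_apply (μ := ν) (ν := m) (hS k)
      have h2 := Measure.prod_apply_symm (μ := ν) (ν := m) (hS k)
      rw [h1] at h2
      refine h2.trans (lintegral_congr fun z => ?_)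
      by_cases hz : z ∈ U
      · simp only [Set.preimage_ofPred_eq, hz, and_true, Set.indicator_of_mem, Pi.one_apply,
          one_mul, hN]
        congr 1; ext x; simp [dist_comm]
      · simp [hz]
    have hsq : ∫⁻ z, N z ^ 2 ∂m ≤ M * V k * V k := by
      have hT : MeasurableSet {w : X × (X × X) | dist w.2.1 w.1 < ε k ∧ dist w.2.2 w.1 < ε k} :=
        ((isOpen_lt (continuous_snd.fst.dist continuous_fst) continuous_const).and
          (isOpen_lt (continuous_snd.snd.dist continuous_fst) continuous_const)).measurableSet
      have h1 := Measure.prod_apply (μ := m) (ν := ν.prod ν) hT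
      have h2 := Measure.prod_apply_symm (μ := m) (ν := ν.prod ν) hT
      have h3 : ∀ z, N z ^ 2 = (ν.prod ν)
          (Prod.mk z ⁻¹' {w : X × (X × X) | dist w.2.1 w.1 < ε k ∧ dist w.2.2 w.1 < ε k}) := by
        intro z
        rw [sq, hN, ← Measure.prod_prod]
        rfl
      simp_rw [h3]
      rw [← h1, h2]
      have hD : MeasurableSet {z : X × X | dist z.1 z.2 < 2 * ε k} :=
        (isOpen_lt (by fun_prop) continuous_const).measurableSet
      calc ∫⁻ y, m ((fun x => (x, y)) ⁻¹'
              {w : X × (X × X) | dist w.2.1 w.1 < ε k ∧ dist w.2.2 w.1 < ε k}) ∂(ν.prod ν)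
          ≤ ∫⁻ y, {z : X × X | dist z.1 z.2 < 2 * ε k}.indicator (fun _ => V k) y
              ∂(ν.prod ν) := by
            refine lintegral_mono fun y => ?_
            by_cases hy : dist y.1 y.2 < 2 * ε k
            · rw [Set.indicator_of_mem (by exact hy), ← hV k y.1]
              refine measure_mono fun x hx => ?_
              rw [Metric.mem_ball, dist_comm]
              exact hx.1
            · rw [Set.indicator_of_notMem (by exact hy)]
              refine le_of_eq (measure_mono_null (fun x hx => hy ?_) measure_empty)
              have := dist_triangle_right y.1 y.2 x
              linarith [hx.1, hx.2]
        _ = V k * (ν.prod ν) {z | dist z.1 z.2 < 2 * ε k} := lintegral_indicator_const hD _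
        _ ≤ V k * (M * V k) := by gcongr; exact hM k
        _ = M * V k * V k := by ring
    have hcs := ENNReal.lintegral_mul_le_Lp_mul_Lq m Real.HolderConjugate.two_two
      (f := U.indicator 1) (g := N)
      ((measurable_one.indicator hU.measurableSet).aemeasurable) hNm.aemeasurable
    have hind : ∫⁻ z, (U.indicator 1 z : ENNReal) ^ (2 : ℝ) ∂m = m U := by
      rw [← lintegral_indicator_one hU.measurableSet]
      refine lintegral_congr fun z => ?_
      by_cases hz : z ∈ U <;> simp [hz]
    have hcs2 : (∫⁻ z, U.indicator 1 z * N z ∂m) ^ 2 ≤ m U * (M * V k * V k) := by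
      calc (∫⁻ z, U.indicator 1 z * N z ∂m) ^ 2
          ≤ ((∫⁻ z, (U.indicator 1 z : ENNReal) ^ (2 : ℝ) ∂m) ^ (1 / 2 : ℝ) *
            (∫⁻ z, N z ^ (2 : ℝ) ∂m) ^ (1 / 2 : ℝ)) ^ 2 := by gcongr; exact hcs
        _ = m U * ∫⁻ z, N z ^ 2 ∂m := by
          rw [hind, mul_pow, ← ENNReal.rpow_natCast, ← ENNReal.rpow_natCast,
            ← ENNReal.rpow_mul, ← ENNReal.rpow_mul]
          norm_num
        _ ≤ _ := by gcongr
    have hmeas : Measurable fun x => m (Metric.ball x (ε k) ∩ U) :=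
      measurable_measure_prodMk_left (ν := m) (hS k)
    simp only [hφ]
    rw [lintegral_const_mul _ hmeas, hswap, mul_pow]
    calc (V k)⁻¹ ^ 2 * (∫⁻ z, U.indicator 1 z * N z ∂m) ^ 2
        ≤ (V k)⁻¹ ^ 2 * (m U * (M * V k * V k)) := by gcongr
      _ = ((V k)⁻¹ * V k) * ((V k)⁻¹ * V k) * (M * m U) := by ring
      _ = M * m U := by rw [ENNReal.inv_mul_cancel (hV0 k) (hVt k)]; ring
  have hlim : ∀ x, U.indicator 1 x ≤ liminf (fun k => φ k x) atTop := by
    intro x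
    by_cases hx : x ∈ U
    · obtain ⟨r, hr, hrU⟩ := Metric.isOpen_iff.1 hU x hx
      have hev : ∀ᶠ k in atTop, φ k x = 1 := by
        filter_upwards [(tendsto_nhdsWithin_iff.1 hε).1.eventually_lt_const hr] with k hk
        simp only [hφ]
        rw [Set.inter_eq_left.2 ((Metric.ball_subset_ball hk.le).trans hrU), hV,
          ENNReal.inv_mul_cancel (hV0 k) (hVt k)]
      rw [liminf_congr hev]
      simp [hx]
    · simp [hx]
  have hfin : ν U ≤ (M * m U) ^ (1 / 2 : ℝ) := by
    calc ν U = ∫⁻ x, U.indicator 1 x ∂ν := (lintegral_indicator_one hU.measurableSet).symm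
      _ ≤ ∫⁻ x, liminf (fun k => φ k x) atTop ∂ν := lintegral_mono hlim
      _ ≤ liminf (fun k => ∫⁻ x, φ k x ∂ν) atTop := lintegral_liminf_le hφm
      _ ≤ _ := by
        refine liminf_le_of_frequently_le' (Frequently.of_forall fun k => ?_)
        have := ENNReal.rpow_le_rpow (hbound k) (z := 1 / 2) (by norm_num)
        rw [← ENNReal.rpow_natCast, ← ENNReal.rpow_mul] at this
        simpa using this
  calc ν U ^ 2 ≤ ((M * m U) ^ (1 / 2 : ℝ)) ^ 2 := by gcongr
    _ = M * m U := by rw [← ENNReal.rpow_natCast, ← ENNReal.rpow_mul]; norm_num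

open Filter Topology in
/-- A finite measure with bounded renormalised correlation at small scales has a square
integrable density; this is the resulting bound on the mass of sets. -/
lemma measure_sq_le {X : Type*} [PseudoMetricSpace X] [SecondCountableTopology X]
    [MeasurableSpace X] [BorelSpace X] (m ν : Measure X) [SFinite m] [m.OuterRegular]
    [IsFiniteMeasure ν] {M : ENNReal} (hMt : M ≠ ⊤) {ε : ℕ → ℝ} {V : ℕ → ENNReal}
    (hε : Tendsto ε atTop (𝓝[>] 0))
    (hV : ∀ k x, m (Metric.ball x (ε k)) = V k) (hV0 : ∀ k, V k ≠ 0) (hVt : ∀ k, V k ≠ ⊤)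
    (hM : ∀ k, (ν.prod ν) {z | dist z.1 z.2 < 2 * ε k} ≤ M * V k) (E : Set X) :
    ν E ^ 2 ≤ M * m E := by
  have hopen := fun U hU => measure_sq_le_of_isOpen m ν hε hV hV0 hVt hM (U := U) hU
  rcases eq_or_ne M 0 with rfl | hM0
  · have := hopen Set.univ isOpen_univ
    rw [zero_mul] at this ⊢
    exact (pow_le_pow_left' (measure_mono E.subset_univ) 2).trans this
  · rw [Set.measure_eq_iInf_isOpen E m]
    simp_rw [ENNReal.mul_iInf_of_ne hM0 hMt]
    refine le_iInf₂ fun U hEU => le_iInf fun hU => ?_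
    exact (pow_le_pow_left' (measure_mono hEU) 2).trans (hopen U hU)

instance : (volume.prod Measure.count : Measure (ℝ × ℤ)).OuterRegular := by
  have : IsFiniteMeasureOnCompacts (Measure.count : Measure ℤ) :=
    ⟨fun K hK => Measure.count_apply_lt_top.2 (isCompact_iff_finite.1 hK)⟩
  infer_instance

open Filter Topology in
lemma exists_map_floor_sq_le (μ : Measure (ℝ × ℝ)) [IsProbabilityMeasure μ]
    {C τ b : ℝ} (hb : 0 < b) (hb1 : b < 1) (hbτ : 1 + 2 * b ≤ τ)
    (hdecay : ∀ ξ : ℝ × ℝ, ξ ≠ 0 → ‖ft2 μ ξ‖ ≤ C * enorm2 ξ ^ (-τ / 2)) :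
    ∃ K : ℝ, 0 ≤ K ∧ ∀ δ : ℝ, 0 < δ → ∀ E : Set (ℝ × ℤ),
      μ.map (fun p => (p.1, ⌊p.2 / δ⌋)) E ^ 2 ≤
        ENNReal.ofReal (K * δ ^ b) * (volume.prod Measure.count) E := by
  obtain ⟨K, hK0, hK⟩ := exists_measure_rectangle_le μ hb hb1 hbτ hdecay
  refine ⟨K, hK0, fun δ hδ E => ?_⟩
  have hf : Measurable fun p : ℝ × ℝ => (p.1, ⌊p.2 / δ⌋) := by fun_prop
  have hpos : ∀ k : ℕ, 0 < 1 / ((k : ℝ) + 2) := fun k => by positivity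
  have hhalf : ∀ k : ℕ, 2 * (1 / ((k : ℝ) + 2)) ≤ 1 := fun k => by
    rw [mul_one_div, div_le_one (by positivity)]; linarith [k.cast_nonneg (α := ℝ)]
  refine measure_sq_le (ε := fun k : ℕ => 1 / ((k : ℝ) + 2))
    (V := fun k => ENNReal.ofReal (2 * (1 / ((k : ℝ) + 2)))) _ _ ENNReal.ofReal_ne_top
    ?_ ?_ ?_ ?_ ?_ E
  · refine tendsto_nhdsWithin_iff.2 ⟨?_, Eventually.of_forall hpos⟩
    have := (tendsto_one_div_add_atTop_nhds_zero_nat (𝕜 := ℝ)).comp (tendsto_add_atTop_nat 1)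
    refine this.congr fun k => ?_
    simp only [Function.comp]
    push_cast
    ring
  · rintro k ⟨x, j⟩
    have hj : Metric.ball j (1 / ((k : ℝ) + 2)) = {j} := by
      ext i
      rw [Metric.mem_ball, Int.dist_eq, Set.mem_singleton_iff]
      refine ⟨fun h => ?_, fun h => by simpa [h] using hpos k⟩
      have h1 : |(i : ℝ) - j| < 1 := by linarith [hhalf k, hpos k]
      have h2 : |i - j| < 1 := by exact_mod_cast h1
      rw [Int.abs_lt_one_iff] at h2
      omega
    rw [← ball_prod_same, Measure.prod_prod, Real.volume_ball, hj, Measure.count_singleton,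
      mul_one]
  · intro k
    have := hpos k
    simpa using by positivity
  · intro k; exact ENNReal.ofReal_ne_top
  · intro k
    rw [Measure.map_prod_map _ _ hf hf,
      Measure.map_apply (hf.prodMap hf) (isOpen_lt (by fun_prop) continuous_const).measurableSet,
      ← ENNReal.ofReal_mul (by positivity)]
    refine le_trans (measure_mono fun z hz => ?_)
      ((hK _ δ (mul_pos two_pos (hpos k)) hδ).trans (le_of_eq (by congr 1; ring)))
    simp only [Set.preimage_ofPred_eq, Set.mem_ofPred_eq, Prod.map_fst, Prod.map_snd, Prod.dist_eq,
      sup_lt_iff] at hz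
    obtain ⟨h1, h2⟩ := hz
    refine ⟨by rw [Real.dist_eq] at h1; exact h1.le, ?_⟩
    have h3 : ⌊z.1.2 / δ⌋ = ⌊z.2.2 / δ⌋ := by
      rw [Int.dist_eq] at h2
      have h3 : |((⌊z.1.2 / δ⌋ - ⌊z.2.2 / δ⌋ : ℤ) : ℝ)| < 1 := by
        push_cast; linarith [hhalf k]
      have h4 : |⌊z.1.2 / δ⌋ - ⌊z.2.2 / δ⌋| < 1 := by exact_mod_cast h3
      rw [Int.abs_lt_one_iff] at h4
      omega
    have h4 := (Int.abs_sub_lt_one_of_floor_eq_floor h3).le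
    rwa [← sub_div, abs_div, abs_of_pos hδ, div_le_one hδ] at h4

lemma pow_three_mul_measure_fst_sq_le (μ : Measure (ℝ × ℝ)) [IsFiniteMeasure μ]
    {δ R : ℝ} {M s : ENNReal}
    (hM : ∀ E : Set (ℝ × ℤ), μ.map (fun p => (p.1, ⌊p.2 / δ⌋)) E ^ 2 ≤
      M * (volume.prod Measure.count) E) :
    s ^ 3 * μ.fst {t | t ∈ Set.Icc (-R) R ∧ ∃ j : ℤ, s ≤ μ.condKernel t {y | ⌊y / δ⌋ = j}} ^ 2 ≤
      M * ENNReal.ofReal (2 * R) := by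
  have hf : Measurable fun p : ℝ × ℝ => (p.1, ⌊p.2 / δ⌋) := by fun_prop
  set J : ℤ → Set ℝ := fun j => {y | ⌊y / δ⌋ = j} with hJ
  have hJm : ∀ j, MeasurableSet (J j) := fun j =>
    (by fun_prop : Measurable fun y : ℝ => ⌊y / δ⌋) (measurableSet_singleton j)
  have hJd : Pairwise (Function.onFun Disjoint J) := fun i j hij =>
    Set.disjoint_left.2 fun y hi hj => hij (hi.symm.trans hj)
  set B : ℤ → Set ℝ := fun j => Set.Icc (-R) R ∩ {t | s ≤ μ.condKernel t (J j)} with hB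
  have hBm : ∀ j, MeasurableSet (B j) := fun j => measurableSet_Icc.inter
    (measurableSet_le measurable_const (μ.condKernel.measurable_coe (hJm j)))
  set E : Set (ℝ × ℤ) := ⋃ j, B j ×ˢ {j} with hE
  have hEm : ∀ j, MeasurableSet (B j ×ˢ ({j} : Set ℤ)) := fun j =>
    (hBm j).prod (measurableSet_singleton j)
  have hEd : Pairwise (Function.onFun Disjoint fun j => B j ×ˢ ({j} : Set ℤ)) := fun i j hij =>
    Set.disjoint_prod.2 (Or.inr (by simpa using hij))
  have h1 : s * μ.fst {t | t ∈ Set.Icc (-R) R ∧ ∃ j : ℤ, s ≤ μ.condKernel t (J j)} ≤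
      μ.map (fun p => (p.1, ⌊p.2 / δ⌋)) E := by
    have hU : {t | t ∈ Set.Icc (-R) R ∧ ∃ j : ℤ, s ≤ μ.condKernel t (J j)} = ⋃ j, B j := by
      ext t; simp [hB]
    rw [hU, hE, measure_iUnion hEd hEm]
    calc s * μ.fst (⋃ j, B j) ≤ s * ∑' j, μ.fst (B j) := by gcongr; exact measure_iUnion_le _
      _ = ∑' j, s * μ.fst (B j) := ENNReal.tsum_mul_left.symm
      _ ≤ _ := by
        refine ENNReal.tsum_le_tsum fun j => ?_
        rw [Measure.map_apply hf (hEm j)]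
        have hpre : (fun p : ℝ × ℝ => (p.1, ⌊p.2 / δ⌋)) ⁻¹' (B j ×ˢ {j}) = B j ×ˢ J j := by
          ext p; simp [hJ]
        rw [hpre]
        calc s * μ.fst (B j) = ∫⁻ _ in B j, s ∂μ.fst := by rw [setLIntegral_const]
          _ ≤ ∫⁻ t in B j, μ.condKernel t (J j) ∂μ.fst :=
            setLIntegral_mono (μ.condKernel.measurable_coe (hJm j)) fun t ht => ht.2
          _ = (μ.fst.compProd μ.condKernel) (B j ×ˢ J j) :=
            (Measure.compProd_apply_prod (hBm j) (hJm j)).symm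
          _ = μ (B j ×ˢ J j) := by rw [μ.disintegrate]
  have h2 : s * (volume.prod Measure.count) E ≤ ENNReal.ofReal (2 * R) := by
    rw [hE, measure_iUnion hEd hEm]
    simp_rw [Measure.prod_prod, Measure.count_singleton, mul_one]
    calc s * ∑' j, volume (B j)
        = ∑' j, ∫⁻ t, (B j).indicator (fun _ => s) t := by
          rw [← ENNReal.tsum_mul_left]
          simp_rw [lintegral_indicator_const (hBm _)]
      _ = ∫⁻ t, ∑' j, (B j).indicator (fun _ => s) t :=
          (lintegral_tsum fun j => (measurable_const.indicator (hBm j)).aemeasurable).symm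
      _ ≤ ∫⁻ t, (Set.Icc (-R) R).indicator (fun _ => 1) t := by
          refine lintegral_mono fun t => ?_
          by_cases ht : t ∈ Set.Icc (-R) R
          · rw [Set.indicator_of_mem ht]
            calc ∑' j, (B j).indicator (fun _ => s) t ≤ ∑' j, μ.condKernel t (J j) := by
                  refine ENNReal.tsum_le_tsum fun j => ?_
                  by_cases h : t ∈ B j
                  · rw [Set.indicator_of_mem h]; exact h.2
                  · rw [Set.indicator_of_notMem h]; exact bot_le
              _ = μ.condKernel t (⋃ j, J j) := (measure_iUnion hJd hJm).symm
              _ ≤ 1 := prob_le_one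
          · simp [hB, ht]
      _ = ENNReal.ofReal (2 * R) := by
          rw [lintegral_indicator_const measurableSet_Icc, one_mul, Real.volume_Icc]
          congr 1; ring
  calc s ^ 3 * μ.fst {t | t ∈ Set.Icc (-R) R ∧ ∃ j : ℤ, s ≤ μ.condKernel t (J j)} ^ 2
      = s * (s * μ.fst {t | t ∈ Set.Icc (-R) R ∧ ∃ j : ℤ, s ≤ μ.condKernel t (J j)}) ^ 2 := by
        ring
    _ ≤ s * (M * (volume.prod Measure.count) E) := by
        gcongr
        exact (pow_le_pow_left' h1 2).trans (hM E)
    _ = M * (s * (volume.prod Measure.count) E) := by ring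
    _ ≤ _ := by gcongr

open Filter Topology in
/-- A mass distribution principle for measures on the line with dyadic decay. -/
lemma dimH_pos_of_eventually_dyadic (κ : Measure ℝ) {β : ℝ} (hβ : 0 < β)
    (h : ∀ᶠ n : ℕ in atTop, ∀ j : ℤ,
      κ {y | ⌊y / (1 / 2 : ℝ) ^ n⌋ = j} < ENNReal.ofReal (((1 / 2 : ℝ) ^ β) ^ n))
    {A : Set ℝ} (hA : κ A ≠ 0) : 0 < dimH A := by
  obtain ⟨n₀, hn₀⟩ := eventually_atTop.1 h
  set r : ℝ := (1 / 2 : ℝ) ^ β with hr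
  have hr0 : 0 < r := by positivity
  have hr1 : r < 1 := Real.rpow_lt_one (by norm_num) (by norm_num) hβ
  have hscale : ∀ n, n₀ ≤ n → ∀ S : Set ℝ, Metric.ediam S ≤ ENNReal.ofReal ((1 / 2) ^ n) →
      κ S ≤ 3 * ENNReal.ofReal (r ^ n) := by
    intro n hn S hS
    rcases S.eq_empty_or_nonempty with rfl | ⟨x, hx⟩
    · simp
    have hδ : (0 : ℝ) < (1 / 2) ^ n := by positivity
    set k : ℤ := ⌊x / (1 / 2 : ℝ) ^ n⌋ with hk
    have hsub : S ⊆ {y | ⌊y / (1 / 2 : ℝ) ^ n⌋ = k - 1} ∪ ({y | ⌊y / (1 / 2 : ℝ) ^ n⌋ = k} ∪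
        {y | ⌊y / (1 / 2 : ℝ) ^ n⌋ = k + 1}) := by
      intro y hy
      have hd : |y - x| ≤ (1 / 2) ^ n := by
        have := (Metric.edist_le_ediam_of_mem hy hx).trans hS
        rwa [edist_dist, ENNReal.ofReal_le_ofReal_iff hδ.le, Real.dist_eq] at this
      have hd' : |y / (1 / 2 : ℝ) ^ n - x / (1 / 2 : ℝ) ^ n| ≤ 1 := by
        rwa [← sub_div, abs_div, abs_of_pos hδ, div_le_one hδ]
      rw [abs_le] at hd'
      have a1 : k - 1 ≤ ⌊y / (1 / 2 : ℝ) ^ n⌋ := by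
        rw [Int.le_floor]; push_cast
        linarith [Int.floor_le (x / (1 / 2 : ℝ) ^ n), hd'.1]
      have a2 : ⌊y / (1 / 2 : ℝ) ^ n⌋ < k + 2 := by
        rw [Int.floor_lt]; push_cast
        linarith [Int.lt_floor_add_one (x / (1 / 2 : ℝ) ^ n), hd'.2]
      have : ⌊y / (1 / 2 : ℝ) ^ n⌋ = k - 1 ∨ ⌊y / (1 / 2 : ℝ) ^ n⌋ = k ∨
        ⌊y / (1 / 2 : ℝ) ^ n⌋ = k + 1 := by omega
      exact this
    calc κ S ≤ _ := measure_mono hsub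
      _ ≤ _ := (measure_union_le _ _).trans (add_le_add le_rfl (measure_union_le _ _))
      _ ≤ ENNReal.ofReal (r ^ n) + (ENNReal.ofReal (r ^ n) + ENNReal.ofReal (r ^ n)) :=
        add_le_add (hn₀ n hn _).le (add_le_add (hn₀ n hn _).le (hn₀ n hn _).le)
      _ = 3 * ENNReal.ofReal (r ^ n) := by ring
  set c : ENNReal := 3 * ENNReal.ofReal r⁻¹ with hc
  have hc0 : c ≠ 0 := by simp [hc, hr0]
  have hct : c ≠ ⊤ := by simp [hc, ENNReal.mul_eq_top]
  have hle : c⁻¹ • κ ≤ Measure.hausdorffMeasure β := by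
    refine Measure.le_hausdorffMeasure β _ (ENNReal.ofReal ((1 / 2) ^ n₀)) (by simp)
      fun S hS => ?_
    rw [Measure.smul_apply, smul_eq_mul, mul_comm, ← div_eq_mul_inv]
    refine ENNReal.div_le_of_le_mul' ?_
    have hdt : Metric.ediam S ≠ ⊤ := ne_top_of_le_ne_top ENNReal.ofReal_ne_top hS
    rcases eq_or_ne (Metric.ediam S) 0 with h0 | h0
    · have hlim : Tendsto (fun n : ℕ => 3 * ENNReal.ofReal (r ^ n)) atTop (𝓝 0) := by
        have := ENNReal.tendsto_ofReal (tendsto_pow_atTop_nhds_zero_of_lt_one hr0.le hr1)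
        simpa using ENNReal.Tendsto.const_mul (a := 3) this (Or.inr (by simp))
      have : κ S ≤ 0 := ge_of_tendsto hlim <| by
        filter_upwards [eventually_ge_atTop n₀] with n hn
        exact hscale n hn S (by simp [h0])
      exact this.trans bot_le
    · set d := (Metric.ediam S).toReal with hd
      have hd0 : 0 < d := ENNReal.toReal_pos h0 hdt
      have hdS : Metric.ediam S = ENNReal.ofReal d := (ENNReal.ofReal_toReal hdt).symm
      rw [hdS, ENNReal.ofReal_le_ofReal_iff (by positivity)] at hS
      obtain ⟨n, hn1, hn2⟩ := exists_nat_pow_near_of_lt_one hd0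
        (hS.trans (pow_le_one₀ (by norm_num) (by norm_num))) (y := (1 / 2 : ℝ)) (by norm_num)
        (by norm_num)
      have hnn : n₀ ≤ n := by
        by_contra hlt
        have := pow_le_pow_of_le_one (a := (1 / 2 : ℝ)) (by norm_num) (by norm_num)
          (show n + 1 ≤ n₀ by omega)
        linarith
      refine (hscale n hnn S (by rw [hdS]; exact ENNReal.ofReal_le_ofReal hn2)).trans ?_
      rw [hc, hdS, ENNReal.ofReal_rpow_of_pos hd0, mul_assoc,
        ← ENNReal.ofReal_mul (by positivity)]
      gcongr
      rw [← div_eq_inv_mul, le_div_iff₀ hr0, ← pow_succ, hr, ← Real.rpow_natCast,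
        ← Real.rpow_mul (by norm_num), mul_comm β, Real.rpow_mul (by norm_num),
        Real.rpow_natCast]
      exact Real.rpow_le_rpow (by positivity) hn1.le hβ.le
  have hH : Measure.hausdorffMeasure ((⟨β, hβ.le⟩ : NNReal) : ℝ) A ≠ 0 := by
    intro h0
    have := (hle A).trans h0.le
    rw [Measure.smul_apply, smul_eq_mul, nonpos_iff_eq_zero, mul_eq_zero, ENNReal.inv_eq_zero]
      at this
    exact this.elim hct hA
  refine lt_of_lt_of_le ?_ (le_dimH_of_hausdorffMeasure_ne_zero hH)
  exact ENNReal.coe_pos.2 hβ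

lemma fst_absolutelyContinuous (μ : Measure (ℝ × ℝ)) {δ : ℝ} {M : ENNReal}
    (hM : ∀ E : Set (ℝ × ℤ), μ.map (fun p => (p.1, ⌊p.2 / δ⌋)) E ^ 2 ≤
      M * (volume.prod Measure.count) E) : μ.fst ≪ volume := by
  refine Measure.AbsolutelyContinuous.mk fun A hA h0 => ?_
  have h := hM (A ×ˢ Set.univ)
  rw [Measure.prod_prod, h0, zero_mul, mul_zero, nonpos_iff_eq_zero, sq_eq_zero_iff,
    Measure.map_apply (by fun_prop) (hA.prod MeasurableSet.univ)] at h
  rw [Measure.fst_apply hA, ← h]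
  congr 1; ext p; simp

lemma ae_eventually_condKernel_lt (μ : Measure (ℝ × ℝ)) [IsProbabilityMeasure μ] {K b : ℝ}
    (hb : 0 < b) (hK0 : 0 ≤ K) (hK : ∀ δ : ℝ, 0 < δ → ∀ E : Set (ℝ × ℤ),
      μ.map (fun p => (p.1, ⌊p.2 / δ⌋)) E ^ 2 ≤
        ENNReal.ofReal (K * δ ^ b) * (volume.prod Measure.count) E) :
    ∀ᵐ t ∂μ.fst, ∀ᶠ n : ℕ in Filter.atTop, ∀ j : ℤ,
      μ.condKernel t {y | ⌊y / (1 / 2 : ℝ) ^ n⌋ = j} <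
        ENNReal.ofReal (((1 / 2 : ℝ) ^ (b / 5)) ^ n) := by
  set r : ℝ := (1 / 2 : ℝ) ^ (b / 5) with hr
  have hr0 : 0 < r := by positivity
  have hr1 : r < 1 := Real.rpow_lt_one (by norm_num) (by norm_num) (by positivity)
  have hr5 : ∀ n : ℕ, ((1 / 2 : ℝ) ^ n) ^ b = r ^ (5 * n) := fun n => by
    rw [hr, ← Real.rpow_natCast, ← Real.rpow_natCast, ← Real.rpow_mul (by norm_num),
      ← Real.rpow_mul (by norm_num)]
    congr 1; push_cast; ring
  have hR : ∀ R : ℕ, ∀ᵐ t ∂μ.fst, ∀ᶠ n : ℕ in Filter.atTop,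
      t ∉ {t | t ∈ Set.Icc (-(R : ℝ)) R ∧ ∃ j : ℤ, ENNReal.ofReal (r ^ n) ≤
        μ.condKernel t {y | ⌊y / (1 / 2 : ℝ) ^ n⌋ = j}} := by
    intro R
    refine ae_eventually_notMem (ne_top_of_le_ne_top ?_ (ENNReal.tsum_le_tsum
      (g := fun n => ENNReal.ofReal (Real.sqrt (K * (2 * R)) * r ^ n)) fun n => ?_))
    · exact ((summable_geometric_of_lt_one hr0.le hr1).mul_left _).tsum_ofReal_ne_top
    · have h := pow_three_mul_measure_fst_sq_le μ (R := R) (s := ENNReal.ofReal (r ^ n))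
        (hK ((1 / 2) ^ n) (by positivity))
      set x := μ.fst {t | t ∈ Set.Icc (-(R : ℝ)) R ∧ ∃ j : ℤ, ENNReal.ofReal (r ^ n) ≤
        μ.condKernel t {y | ⌊y / (1 / 2 : ℝ) ^ n⌋ = j}} with hx
      have hxt : x ≠ ⊤ := measure_ne_top _ _
      rw [← ENNReal.ofReal_toReal hxt] at h ⊢
      set y := x.toReal
      have hy0 : 0 ≤ y := ENNReal.toReal_nonneg
      rw [← ENNReal.ofReal_pow (by positivity), ← ENNReal.ofReal_pow hy0,
        ← ENNReal.ofReal_mul (by positivity), ← ENNReal.ofReal_mul (by positivity),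
        ENNReal.ofReal_le_ofReal_iff (by positivity), hr5] at h
      refine ENNReal.ofReal_le_ofReal ((sq_le_sq₀ hy0 (by positivity)).1 ?_)
      rw [mul_pow, Real.sq_sqrt (by positivity)]
      have hp : 0 < (r ^ n) ^ 3 := by positivity
      refine le_of_mul_le_mul_left (h.trans (le_of_eq ?_)) hp
      ring
  filter_upwards [ae_all_iff.2 hR] with t ht
  obtain ⟨R, hRt⟩ := exists_nat_ge |t|
  filter_upwards [ht R] with n hn j
  by_contra hlt
  exact hn ⟨abs_le.1 hRt, j, not_lt.1 hlt⟩

lemma ae_condKernel_msupport_ne_zero (μ : Measure (ℝ × ℝ)) [IsProbabilityMeasure μ] :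
    ∀ᵐ t ∂μ.fst, μ.condKernel t {y | (t, y) ∈ msupport μ} ≠ 0 := by
  have hsupp : msupport μ = μ.support := by
    ext x; exact (Measure.mem_support_iff_forall x).symm
  have h : ∀ᵐ p ∂μ.fst.compProd μ.condKernel, p ∈ msupport μ := by
    rw [μ.disintegrate, hsupp]
    exact Measure.support_mem_ae
  filter_upwards [Measure.ae_ae_of_ae_compProd h] with t ht
  intro h0
  have hfalse : ∀ᵐ _ ∂μ.condKernel t, False := by
    filter_upwards [ht, measure_eq_zero_iff_ae_notMem.1 h0] with y hy hy'
    exact hy' hy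
  exact hfalse.exists.elim fun _ h => h

theorem slices_positive_dimension (μ : Measure (ℝ × ℝ)) [IsProbabilityMeasure μ]
    (C τ : ℝ) (hC : 0 < C) (hτ : 1 < τ)
    (hdecay : ∀ ξ : ℝ × ℝ, ξ ≠ 0 → ‖ft2 μ ξ‖ ≤ C * enorm2 ξ ^ (-τ / 2)) :
    0 < volume {t : ℝ | 0 < dimH ({p : ℝ × ℝ | p.1 = t} ∩ msupport μ)} := by
  obtain ⟨b, hb, hb1, hbτ⟩ : ∃ b : ℝ, 0 < b ∧ b < 1 ∧ 1 + 2 * b ≤ τ :=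
    ⟨min (1 / 2) ((τ - 1) / 2), lt_min (by norm_num) (by linarith),
      (min_le_left _ _).trans_lt (by norm_num),
      by linarith [min_le_right (1 / 2 : ℝ) ((τ - 1) / 2)]⟩
  obtain ⟨K, hK0, hK⟩ := exists_map_floor_sq_le μ hb hb1 hbτ hdecay
  rw [pos_iff_ne_zero]
  intro h0
  have hnull := fst_absolutelyContinuous μ (hK 1 one_pos) h0
  have hfalse : ∀ᵐ _ ∂μ.fst, False := by
    filter_upwards [measure_eq_zero_iff_ae_notMem.1 hnull, ae_eventually_condKernel_lt μ hb hK0 hK,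
      ae_condKernel_msupport_ne_zero μ] with t ht hdyadic hpos
    refine ht ?_
    have himage : {p : ℝ × ℝ | p.1 = t} ∩ msupport μ =
        Prod.mk t '' {y | (t, y) ∈ msupport μ} := by
      ext ⟨x, y⟩
      constructor
      · rintro ⟨rfl, h⟩
        exact ⟨y, h, rfl⟩
      · rintro ⟨z, hz, hzy⟩
        obtain ⟨rfl, rfl⟩ := Prod.mk.inj hzy
        exact ⟨rfl, hz⟩
    have hiso : Isometry (Prod.mk t : ℝ → ℝ × ℝ) := fun x y => by simp [Prod.edist_eq]
    rw [himage, hiso.dimH_image]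
    exact dimH_pos_of_eventually_dyadic _ (by positivity) hdyadic hpos
  exact hfalse.exists.elim fun _ h => h
end

section
/- Every function f ∈ C[0,1] can be written as f = f₁ + f₂ where f₁, f₂ ∈ C[0,1] are such that for every Borel probability measure μ supported on G_{f₁} or G_{f₂}, the Fourier transform μ̂ does not tend to zero at infinity. -/
open MeasureTheory Filter Set

def graphOf (f : C(Set.Icc (0:ℝ) 1, ℝ)) : Set (ℝ × ℝ) :=
  {p : ℝ × ℝ | ∃ x : Set.Icc (0:ℝ) 1, p.1 = (x : ℝ) ∧ p.2 = f x}

/-- The test polynomial `cos θ + cos 2θ` at `θ = 2πt` is at least `-9/8` everywhere, and close to `2`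
near the integers. -/
noncomputable def cosPair (t : ℝ) : ℝ :=
  Real.cos (2 * Real.pi * t) + Real.cos (2 * Real.pi * (2 * t))

lemma cosPair_eq (t : ℝ) :
    cosPair t = Real.cos (2 * Real.pi * t) + 2 * Real.cos (2 * Real.pi * t) ^ 2 - 1 := by
  rw [cosPair, show 2 * Real.pi * (2 * t) = 2 * (2 * Real.pi * t) by ring, Real.cos_two_mul]
  ring

lemma neg_nine_eighths_le_cosPair (t : ℝ) : -(9 / 8) ≤ cosPair t := by
  rw [cosPair_eq]
  nlinarith [sq_nonneg (Real.cos (2 * Real.pi * t) + 1 / 4)]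

lemma lt_cosPair_of_le_cos {t : ℝ} (h : 7 / 8 ≤ Real.cos (2 * Real.pi * t)) :
    11 / 8 < cosPair t := by
  rw [cosPair_eq]
  nlinarith

lemma continuous_cosPair : Continuous cosPair := by
  unfold cosPair
  fun_prop

/-- Functions whose graph stays close to a fine grid of horizontal and vertical lines, as measured
by `cosPair`. -/
def nearGrid (n : ℕ) : Set C(Set.Icc (0:ℝ) 1, ℝ) :=
  {f | ∃ a b : ℕ, n ≤ a ∧ n ≤ b ∧ ∀ x : Set.Icc (0:ℝ) 1, 1 / 8 < cosPair (a * (x : ℝ)) + cosPair (b * f x)}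

lemma isOpen_nearGrid (n : ℕ) : IsOpen (nearGrid n) := by
  have key (a b : ℕ) : IsOpen {f : C(Set.Icc (0:ℝ) 1, ℝ) |
      ∀ x : Set.Icc (0:ℝ) 1, 1 / 8 < cosPair (a * (x : ℝ)) + cosPair (b * f x)} := by
    have hc : IsClosed {q : C(Set.Icc (0:ℝ) 1, ℝ) × Set.Icc (0:ℝ) 1 |
        cosPair (a * (q.2 : ℝ)) + cosPair (b * q.1 q.2) ≤ 1 / 8} := by
      refine isClosed_le ?_ continuous_const
      have := continuous_cosPair
      fun_prop
    convert (isClosedMap_fst_of_compactSpace _ hc).isOpen_compl using 1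
    ext f
    simp
  have : nearGrid n = ⋃ (a : ℕ) (b : ℕ) (_ : n ≤ a ∧ n ≤ b), {f : C(Set.Icc (0:ℝ) 1, ℝ) |
      ∀ x : Set.Icc (0:ℝ) 1, 1 / 8 < cosPair (a * (x : ℝ)) + cosPair (b * f x)} := by
    ext f
    simp [nearGrid]
  rw [this]
  exact isOpen_iUnion fun a => isOpen_iUnion fun b => isOpen_iUnion fun _ => key a b

/-- Simultaneous recurrence: arbitrarily large multiples of finitely many reals are simultaneously
close to integers. -/
lemma exists_nat_forall_le_cos {ι : Type*} [Fintype ι] (y : ι → ℝ) (n : ℕ) :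
    ∃ b : ℕ, n ≤ b ∧ ∀ i, 7 / 8 ≤ Real.cos (2 * Real.pi * (b * y i)) := by
  obtain ⟨z, φ, hφ, hz⟩ := CompactSpace.tendsto_subseq
    (fun (m : ℕ) (i : ι) => Circle.exp (m * (2 * Real.pi * y i)))
  obtain ⟨N, hN⟩ := Metric.cauchySeq_iff.1 hz.cauchySeq (1 / 8) (by norm_num)
  have hle : φ N + n ≤ φ (N + n) := by
    clear hz hN
    induction n with
    | zero => simp
    | succ k ih =>
      have := hφ (show N + k < N + (k + 1) by omega)
      omega
  refine ⟨φ (N + n) - φ N, by omega, fun i => ?_⟩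
  have h := (dist_le_pi_dist _ _ i).trans_lt (hN (N + n) (by omega) N le_rfl)
  rw [Nat.cast_sub (by omega)]
  set p : ℝ := φ (N + n) * (2 * Real.pi * y i) with hp
  set q : ℝ := φ N * (2 * Real.pi * y i) with hq
  have hd : ‖Complex.exp ((p - q : ℝ) * Complex.I) - 1‖ < 1 / 8 := by
    have hmul : Complex.exp (p * Complex.I) - Complex.exp (q * Complex.I) =
        (Complex.exp ((p - q : ℝ) * Complex.I) - 1) * Complex.exp (q * Complex.I) := by
      rw [sub_mul, ← Complex.exp_add, one_mul]
      congr 2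
      push_cast
      ring
    change dist (Circle.exp p : ℂ) (Circle.exp q) < 1 / 8 at h
    rwa [Circle.coe_exp, Circle.coe_exp, Complex.dist_eq, hmul, norm_mul, Complex.norm_exp_ofReal_mul_I, mul_one] at h
  have hre := (Complex.abs_re_le_norm _).trans hd.le
  rw [Complex.sub_re, Complex.exp_ofReal_mul_I_re] at hre
  have harg : 2 * Real.pi * (((φ (N + n) : ℝ) - φ N) * y i) = p - q := by
    rw [hp, hq]; ring
  rw [harg]
  have := (abs_le.1 hre).1
  simp at this
  linarith

/-- A continuous staircase close to the identity, constant at distance `1 / 20` to the right of each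
integer up to the next one. -/
lemma exists_continuous_staircase : ∃ h : ℝ → ℝ, Continuous h ∧ (∀ t, |h t - t| ≤ 1) ∧
    ∀ t, 1 / 20 ≤ Int.fract t → h t = ⌊t⌋ + 1 := by
  refine ⟨fun t => t + (min 1 (20 * Int.fract t) - Int.fract t), ?_, fun t => ?_, fun t ht => ?_⟩
  · have : Continuous ((fun s : ℝ => min 1 (20 * s) - s) ∘ Int.fract) :=
      ContinuousOn.comp_fract'' (by fun_prop) (by norm_num)
    exact continuous_id.add this
  · have h0 := Int.fract_nonneg t
    have h1 := (Int.fract_lt_one t).le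
    rw [add_sub_cancel_left, abs_le]
    constructor
    · have : 0 ≤ min 1 (20 * Int.fract t) := by positivity
      linarith
    · linarith [min_le_left 1 (20 * Int.fract t)]
  · have := Int.floor_add_fract t
    simp only
    rw [min_eq_left (by linarith)]
    linarith

lemma dense_nearGrid (n : ℕ) : Dense (nearGrid n) := by
  refine Metric.dense_iff.2 fun g r hr => ?_
  obtain ⟨δ, hδ, hg⟩ := Metric.uniformContinuous_iff.1
    (CompactSpace.uniformContinuous_of_continuous g.continuous) (r / 2) (by positivity)
  obtain ⟨m, hm⟩ := exists_nat_gt (1 / δ)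
  set a : ℕ := max n (m + 1) with ha
  have ha0 : (0 : ℝ) < a := by
    have : 0 < a := by omega
    exact_mod_cast this
  have hmδ : 1 / (a : ℝ) < δ := by
    rw [one_div_lt ha0 hδ]
    refine hm.trans_le ?_
    exact_mod_cast (by omega : m ≤ a)
  obtain ⟨h, hcont, hclose, hconst⟩ := exists_continuous_staircase
  let φ : C(Set.Icc (0:ℝ) 1, Set.Icc (0:ℝ) 1) :=
    ⟨fun x => Set.projIcc 0 1 zero_le_one (h (a * x) / a), by
      exact continuous_projIcc.comp (by fun_prop)⟩
  obtain ⟨b, hb, hcos⟩ := exists_nat_forall_le_cos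
    (fun k : Fin (a + 2) => g (Set.projIcc 0 1 zero_le_one ((k : ℕ) / a))) n
  refine ⟨g.comp φ, ?_, a, b, le_max_left _ _, hb, fun x => ?_⟩
  · rw [Metric.mem_ball]
    refine ((ContinuousMap.dist_le (by positivity : 0 ≤ r / 2)).2 fun x => ?_).trans_lt
      (half_lt_self hr)
    refine (hg ?_).le
    have hx : x = Set.projIcc 0 1 zero_le_one (x : ℝ) := (Set.projIcc_val _ x).symm
    have hle : |h (a * x) / a - x| ≤ 1 / a := by
      have : h (a * x) / a - x = (h (a * x) - a * x) / a := by field_simp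
      rw [this, abs_div, abs_of_pos ha0]
      gcongr
      exact hclose _
    calc dist (φ x) x = |(Set.projIcc 0 1 zero_le_one (h (a * x) / a) : ℝ)
          - Set.projIcc (0 : ℝ) 1 zero_le_one (x : ℝ)| := by
            rw [← hx]; rfl
      _ ≤ |h (a * x) / a - x| := Set.abs_projIcc_sub_projIcc _
      _ < δ := hle.trans_lt hmδ
  · by_cases hf : Int.fract ((a : ℝ) * x) < 1 / 20
    · have h1 : 11 / 8 < cosPair (a * (x : ℝ)) := by
        refine lt_cosPair_of_le_cos ?_
        have harg : 2 * Real.pi * (a * (x : ℝ)) =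
            2 * Real.pi * Int.fract ((a : ℝ) * x) + (⌊(a : ℝ) * x⌋ : ℤ) * (2 * Real.pi) := by
          conv_lhs => rw [← Int.floor_add_fract ((a : ℝ) * x)]
          ring
        rw [harg, Real.cos_add_int_mul_two_pi]
        refine le_trans ?_ Real.one_sub_sq_div_two_le_cos
        have h0 := Int.fract_nonneg ((a : ℝ) * x)
        have hs : 2 * Real.pi * Int.fract ((a : ℝ) * x) ≤ 2 * 4 * (1 / 20) := by
          gcongr
          exact Real.pi_le_four
        have hs0 : 0 ≤ 2 * Real.pi * Int.fract ((a : ℝ) * x) := by positivity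
        nlinarith
      linarith [neg_nine_eighths_le_cosPair (b * (g.comp φ) x)]
    · have hx0 : 0 ≤ (a : ℝ) * x := mul_nonneg ha0.le x.2.1
      have hx1 : (a : ℝ) * x ≤ a := mul_le_of_le_one_right ha0.le x.2.2
      have hfl : ⌊(a : ℝ) * x⌋ = (⌊(a : ℝ) * x⌋₊ : ℤ) := (Int.natCast_floor_eq_floor hx0).symm
      have hk : ⌊(a : ℝ) * x⌋₊ + 1 < a + 2 := by
        have := Nat.floor_le_of_le hx1
        omega
      have h2 : 11 / 8 < cosPair (b * (g.comp φ) x) := by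
        refine lt_cosPair_of_le_cos ?_
        convert hcos ⟨⌊(a : ℝ) * x⌋₊ + 1, hk⟩ using 4
        change g (Set.projIcc 0 1 zero_le_one (h (a * x) / a)) = _
        rw [hconst _ (not_lt.1 hf), hfl]
        push_cast
        rfl
      linarith [neg_nine_eighths_le_cosPair (a * (x : ℝ))]

lemma integrable_cos_comp (μ : Measure (ℝ × ℝ)) [IsFiniteMeasure μ] {u : ℝ × ℝ → ℝ}
    (hu : Continuous u) : Integrable (fun p => Real.cos (u p)) μ :=
  .of_bound (by fun_prop) 1 (ae_of_all _ fun p => Real.abs_cos_le_one _)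

lemma re_ft2 (μ : Measure (ℝ × ℝ)) [IsFiniteMeasure μ] (ξ : ℝ × ℝ) :
    (ft2 μ ξ).re = ∫ p, Real.cos (2 * Real.pi * (p.1 * ξ.1 + p.2 * ξ.2)) ∂μ := by
  have heq (p : ℝ × ℝ) : Complex.exp (-2 * Real.pi * Complex.I *
      ((p.1 * ξ.1 + p.2 * ξ.2 : ℝ) : ℂ)) =
      Complex.exp ((-(2 * Real.pi * (p.1 * ξ.1 + p.2 * ξ.2)) : ℝ) * Complex.I) := by
    congr 1
    push_cast
    ring
  have hint : Integrable (fun p : ℝ × ℝ =>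
      Complex.exp ((-(2 * Real.pi * (p.1 * ξ.1 + p.2 * ξ.2)) : ℝ) * Complex.I)) μ :=
    .of_bound (by fun_prop) 1 (ae_of_all _ fun p => (Complex.norm_exp_ofReal_mul_I _).le)
  simp only [ft2, heq]
  have := integral_re hint
  simp only [RCLike.re_to_complex, Complex.exp_ofReal_mul_I_re, Real.cos_neg] at this
  exact this.symm

lemma not_tendsto_ft2_of_forall_mem_nearGrid {f : C(Set.Icc (0:ℝ) 1, ℝ)}
    (hf : ∀ n, f ∈ nearGrid n) (μ : Measure (ℝ × ℝ)) [IsProbabilityMeasure μ]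
    (hμ : μ (graphOf f)ᶜ = 0) :
    ¬ Tendsto (fun ξ : ℝ × ℝ => ‖ft2 μ ξ‖) (cocompact (ℝ × ℝ)) (nhds 0) := by
  intro ht
  have hev := ht.eventually_lt_const (show (0 : ℝ) < 1 / 32 by norm_num)
  rw [← Metric.cobounded_eq_cocompact, ← comap_norm_atTop, eventually_comap,
    eventually_atTop] at hev
  obtain ⟨r, hr⟩ := hev
  obtain ⟨n, hn⟩ := exists_nat_ge r
  obtain ⟨a, b, ha, hb, hab⟩ := hf n
  have hre (ξ : ℝ × ℝ) (hξ : r ≤ ‖ξ‖) : (ft2 μ ξ).re < 1 / 32 :=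
    (Complex.re_le_norm _).trans_lt (hr _ hξ ξ rfl)
  have ha' : r ≤ a := hn.trans (by exact_mod_cast ha)
  have hb' : r ≤ b := hn.trans (by exact_mod_cast hb)
  have h1 := hre (a, 0) (ha'.trans (by simp [Prod.norm_def]))
  have h2 := hre (2 * a, 0) (ha'.trans (by simp [Prod.norm_def]; linarith [a.cast_nonneg (α := ℝ)]))
  have h3 := hre (0, b) (hb'.trans (by simp [Prod.norm_def]))
  have h4 := hre (0, 2 * b) (hb'.trans (by simp [Prod.norm_def]; linarith [b.cast_nonneg (α := ℝ)]))
  rw [re_ft2] at h1 h2 h3 h4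
  have i1 : Integrable (fun p : ℝ × ℝ => Real.cos (2 * Real.pi * (p.1 * a + p.2 * 0))) μ :=
    integrable_cos_comp μ (by fun_prop)
  have i2 : Integrable (fun p : ℝ × ℝ => Real.cos (2 * Real.pi * (p.1 * (2 * a) + p.2 * 0))) μ :=
    integrable_cos_comp μ (by fun_prop)
  have i3 : Integrable (fun p : ℝ × ℝ => Real.cos (2 * Real.pi * (p.1 * 0 + p.2 * b))) μ :=
    integrable_cos_comp μ (by fun_prop)
  have i4 : Integrable (fun p : ℝ × ℝ => Real.cos (2 * Real.pi * (p.1 * 0 + p.2 * (2 * b)))) μ :=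
    integrable_cos_comp μ (by fun_prop)
  have hle : ∫ _ : ℝ × ℝ, (1 / 8 : ℝ) ∂μ ≤ ∫ p : ℝ × ℝ,
      (Real.cos (2 * Real.pi * (p.1 * a + p.2 * 0)) +
        Real.cos (2 * Real.pi * (p.1 * (2 * a) + p.2 * 0))) +
      (Real.cos (2 * Real.pi * (p.1 * 0 + p.2 * b)) +
        Real.cos (2 * Real.pi * (p.1 * 0 + p.2 * (2 * b)))) ∂μ := by
    refine integral_mono_ae (integrable_const _) ((i1.add i2).add (i3.add i4)) ?_
    have hae : ∀ᵐ p ∂μ, p ∈ graphOf f := hμ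
    filter_upwards [hae] with p hp
    obtain ⟨x, hx, hy⟩ := hp
    have := (hab x).le
    rw [← hx, ← hy] at this
    simp only [cosPair] at this
    convert this using 4 <;> ring_nf
  have hsum := integral_add (i1.add i2) (i3.add i4)
  simp only [Pi.add_apply] at hsum
  rw [hsum, integral_add i1 i2, integral_add i3 i4] at hle
  simp at hle h1 h2 h3 h4
  linarith

/-- In a Baire topological group, every element is the sum of two elements of any countable
intersection of dense open sets. -/
lemma exists_add_eq_of_isOpen_of_dense {G : Type*} [AddCommGroup G] [TopologicalSpace G]
    [IsTopologicalAddGroup G] [BaireSpace G] {U : ℕ → Set G} (ho : ∀ n, IsOpen (U n))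
    (hd : ∀ n, Dense (U n)) (g : G) :
    ∃ g₁ g₂, g = g₁ + g₂ ∧ (∀ n, g₁ ∈ U n) ∧ ∀ n, g₂ ∈ U n := by
  have hdense : Dense (⋂ n, U n ∩ Homeomorph.subLeft g ⁻¹' U n) :=
    dense_iInter_of_isOpen
      (fun n => (ho n).inter ((ho n).preimage (Homeomorph.subLeft g).continuous))
      (fun n => (hd n).inter_of_isOpen_left
        ((hd n).preimage (Homeomorph.subLeft g).isOpenMap) (ho n))
  obtain ⟨g₁, hg₁⟩ := hdense.nonempty
  rw [mem_iInter] at hg₁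
  exact ⟨g₁, g - g₁, by abel, fun n => (hg₁ n).1, fun n => (hg₁ n).2⟩

theorem decomposition_no_rajchman (f : C(Set.Icc (0:ℝ) 1, ℝ)) :
    ∃ f₁ f₂ : C(Set.Icc (0:ℝ) 1, ℝ), f = f₁ + f₂ ∧
      (∀ μ : Measure (ℝ × ℝ), IsProbabilityMeasure μ → μ (graphOf f₁)ᶜ = 0 →
        ¬ Tendsto (fun ξ : ℝ × ℝ => ‖ft2 μ ξ‖) (cocompact (ℝ × ℝ)) (nhds 0)) ∧
      (∀ μ : Measure (ℝ × ℝ), IsProbabilityMeasure μ → μ (graphOf f₂)ᶜ = 0 →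
        ¬ Tendsto (fun ξ : ℝ × ℝ => ‖ft2 μ ξ‖) (cocompact (ℝ × ℝ)) (nhds 0)) := by
  obtain ⟨f₁, f₂, hf, h₁, h₂⟩ :=
    exists_add_eq_of_isOpen_of_dense isOpen_nearGrid dense_nearGrid f
  exact ⟨f₁, f₂, hf, fun μ _ => not_tendsto_ft2_of_forall_mem_nearGrid h₁ μ,
    fun μ _ => not_tendsto_ft2_of_forall_mem_nearGrid h₂ μ⟩
end
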